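/- Let k ≥ 1, let ε ≥ 0 satisfy ν e_j ≤ ε for all 1 ≤ j ≤ k, and assume the series Σ_{i=0}^∞ γ^i c(i) converges. Then μ(v_{π*} − v_{k,m}) ≤ (Σ_{i=0}^∞ γ^i c(i)) · ⌈k/m⌉ · ε + 2 γ^k Vmax; that is, μ(v_{π*} − v_{k,m}) ≤ (C^{(1,0)}/(1−γ)) · ⌈k/m⌉ · ε + 2 γ^k Vmax, where C^{(1,0)} = (1−γ) Σ_{i≥0} γ^i c(i). -/

import Mathlib

open Finset Matrix

noncomputable section

/-- Transition matrix of a deterministic stationary policy. -/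
def polMat {S A : Type*} (P : S → A → S → ℝ) (π : S → A) : Matrix S S ℝ :=
  Matrix.of fun s s' => P s (π s) s'

/-- Bellman operator `T_π v = r + γ P_π v` of a deterministic stationary policy. -/
def bOp {S A : Type*} [Fintype S] (P : S → A → S → ℝ) (γ : ℝ) (r : S → ℝ)
    (π : S → A) (v : S → ℝ) : S → ℝ :=
  fun s => r s + γ * ∑ s' : S, P s (π s) s' * v s'

/-- `errOf P γ r v π = max_{π'} T_{π'} v − T_π v` (componentwise maximum over all
deterministic stationary policies `π'`). -/
def errOf {S A : Type*} [Fintype S] [Fintype A] [DecidableEq S] [Nonempty A]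
    (P : S → A → S → ℝ) (γ : ℝ) (r : S → ℝ) (v : S → ℝ) (π : S → A) : S → ℝ :=
  fun s => (Finset.univ.sup' Finset.univ_nonempty fun π' : S → A => bOp P γ r π' v s)
    - bOp P γ r π v s

/-- Values of the PSDP∞ non-stationary policies: `vSig P γ r πseq k = v_{σ_k}
= T_{π_k} T_{π_{k-1}} ⋯ T_{π_1} r` (so `vSig P γ r πseq 0 = r`). -/
def vSig {S A : Type*} [Fintype S] (P : S → A → S → ℝ) (γ : ℝ) (r : S → ℝ)
    (πseq : ℕ → S → A) : ℕ → S → ℝ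
  | 0 => r
  | k+1 => bOp P γ r (πseq (k+1)) (vSig P γ r πseq k)


/-- The composed NSPI operator
`nsRun P γ r πseq j m v = T_{π_j} T_{π_{j−1}} ⋯ T_{π_{j−m+1}} v` (identity for `m = 0`). -/
def nsRun {S A : Type*} [Fintype S] (P : S → A → S → ℝ) (γ : ℝ) (r : S → ℝ)
    (πseq : ℤ → S → A) : ℤ → ℕ → (S → ℝ) → (S → ℝ)
  | _, 0, v => v
  | j, m+1, v => bOp P γ r (πseq j) (nsRun P γ r πseq (j-1) m v)

/-- `gamMat P γ πseq j m = Γ_{j,m} = (γP_{π_j})(γP_{π_{j−1}})⋯(γP_{π_{j−m+1}})`. -/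
def gamMat {S A : Type*} [Fintype S] [DecidableEq S]
    (P : S → A → S → ℝ) (γ : ℝ) (πseq : ℤ → S → A) (j : ℤ) (m : ℕ) : Matrix S S ℝ :=
  ((List.range m).map fun i => γ • polMat P (πseq (j - (i : ℤ)))).prod

/-- Product of the discounted transition matrices along a word of policies. -/
def discMat {S A : Type*} [Fintype S] [DecidableEq S] (P : S → A → S → ℝ) (γ : ℝ)
    (l : List (S → A)) : Matrix S S ℝ :=
  (l.map fun π => γ • polMat P π).prod

/-- The word `π_j, π_{j-1}, …, π_{j-m+1}`. -/
def polWord {S A : Type*} (πseq : ℤ → S → A) : ℤ → ℕ → List (S → A)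
  | _, 0 => []
  | j, m+1 => πseq j :: polWord πseq (j-1) m

lemma length_polWord {S A : Type*} (πseq : ℤ → S → A) (j : ℤ) (m : ℕ) :
    (polWord πseq j m).length = m := by
  induction m generalizing j with
  | zero => rfl
  | succ m ih => simp [polWord, ih]

lemma mulVec_mono_of_nonneg {S : Type*} [Fintype S] {M : Matrix S S ℝ}
    (hM : ∀ s t, 0 ≤ M s t) {x y : S → ℝ} (h : x ≤ y) : M *ᵥ x ≤ M *ᵥ y :=
  fun s => Finset.sum_le_sum fun t _ => mul_le_mul_of_nonneg_left (h t) (hM s t)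

section Operators

variable {S A : Type*} [Fintype S] {P : S → A → S → ℝ} {γ : ℝ} {r : S → ℝ}

lemma bOp_sub_bOp (π : S → A) (v w : S → ℝ) :
    bOp P γ r π v - bOp P γ r π w = (γ • polMat P π) *ᵥ (v - w) := by
  rw [Matrix.smul_mulVec]
  ext s
  simp only [bOp, polMat, Pi.sub_apply, Pi.smul_apply, smul_eq_mul,
    Matrix.mulVec, dotProduct, Matrix.of_apply, mul_sub, Finset.sum_sub_distrib]
  ring

lemma nsRun_succ_right (πseq : ℤ → S → A) (j : ℤ) (m : ℕ) (v : S → ℝ) :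
    nsRun P γ r πseq j (m+1) v = nsRun P γ r πseq j m (bOp P γ r (πseq (j - m)) v) := by
  induction m generalizing j with
  | zero => simp [nsRun]
  | succ m ih =>
    rw [nsRun, ih, nsRun]
    congr 4
    push_cast
    ring

lemma abs_nsRun_le (hP0 : ∀ s a s', 0 ≤ P s a s') (hP1 : ∀ s a, ∑ s' : S, P s a s' = 1)
    (hγ0 : 0 < γ) (hγ1 : γ < 1) {Rmax : ℝ} (hr : ∀ s, |r s| ≤ Rmax) (πseq : ℤ → S → A)
    (j : ℤ) (m : ℕ) {v : S → ℝ} {B : ℝ} (hv : ∀ s, |v s| ≤ Rmax / (1 - γ) + B) (s : S) :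
    |nsRun P γ r πseq j m v s| ≤ Rmax / (1 - γ) + γ ^ m * B := by
  induction m generalizing j s with
  | zero => simpa [nsRun] using hv s
  | succ m ih =>
    have hne : 1 - γ ≠ 0 := by linarith
    set w := nsRun P γ r πseq (j-1) m v with hw
    have hsum : |∑ s' : S, P s (πseq j s) s' * w s'| ≤ Rmax / (1 - γ) + γ ^ m * B := by
      calc |∑ s' : S, P s (πseq j s) s' * w s'|
          ≤ ∑ s' : S, |P s (πseq j s) s' * w s'| := Finset.abs_sum_le_sum_abs _ _
        _ ≤ ∑ s' : S, P s (πseq j s) s' * (Rmax / (1 - γ) + γ ^ m * B) := by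
          refine Finset.sum_le_sum fun s' _ => ?_
          rw [abs_mul, abs_of_nonneg (hP0 _ _ _)]
          exact mul_le_mul_of_nonneg_left (ih (j-1) s') (hP0 _ _ _)
        _ = _ := by rw [← Finset.sum_mul, hP1, one_mul]
    calc |nsRun P γ r πseq j (m+1) v s|
        ≤ |r s| + |γ * ∑ s' : S, P s (πseq j s) s' * w s'| := abs_add_le _ _
      _ ≤ Rmax + γ * (Rmax / (1 - γ) + γ ^ m * B) := by
        rw [abs_mul, abs_of_pos hγ0]
        exact add_le_add (hr s) (mul_le_mul_of_nonneg_left hsum hγ0.le)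
      _ = _ := by field_simp; ring

lemma abs_le_of_nsRun_eq [Nonempty S] (hP0 : ∀ s a s', 0 ≤ P s a s')
    (hP1 : ∀ s a, ∑ s' : S, P s a s' = 1)
    (hγ0 : 0 < γ) (hγ1 : γ < 1) {Rmax : ℝ} (hr : ∀ s, |r s| ≤ Rmax) (πseq : ℤ → S → A)
    (j : ℤ) {m : ℕ} (hm : 1 ≤ m) {v : S → ℝ} (hv : nsRun P γ r πseq j m v = v) (s : S) :
    |v s| ≤ Rmax / (1 - γ) := by
  obtain ⟨t, ht⟩ := Finite.exists_max fun s => |v s|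
  have h := abs_nsRun_le hP0 hP1 hγ0 hγ1 hr πseq j m (v := v) (B := |v t| - Rmax / (1 - γ))
    (fun s => by linarith [ht s]) t
  rw [hv] at h
  have hpow : γ ^ m < 1 := pow_lt_one₀ hγ0.le hγ1 (by lia)
  nlinarith [ht s]

variable [DecidableEq S]

lemma discMat_append (l l' : List (S → A)) :
    discMat P γ (l ++ l') = discMat P γ l * discMat P γ l' := by
  simp [discMat]

lemma discMat_flatten_replicate (l : List (S → A)) (n : ℕ) :
    discMat P γ (List.replicate n l).flatten = discMat P γ l ^ n := by
  induction n with
  | zero => simp [discMat]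
  | succ n ih => rw [List.replicate_succ, List.flatten_cons, discMat_append, ih, pow_succ']

lemma discMat_eq_smul (l : List (S → A)) :
    discMat P γ l = γ ^ l.length • (l.map (polMat P)).prod := by
  induction l with
  | nil => simp [discMat]
  | cons π l ih =>
    have : discMat P γ (π :: l) = (γ • polMat P π) * discMat P γ l := by simp [discMat]
    rw [this, ih]
    simp [smul_smul, pow_succ, mul_comm]

lemma discMat_nonneg (hP0 : ∀ s a s', 0 ≤ P s a s') (hγ0 : 0 ≤ γ) (l : List (S → A)) (s t : S) :
    0 ≤ discMat P γ l s t := by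
  induction l generalizing s with
  | nil => simp only [discMat, List.map_nil, List.prod_nil, Matrix.one_apply]; positivity
  | cons π l ih =>
    have : discMat P γ (π :: l) = (γ • polMat P π) * discMat P γ l := by simp [discMat]
    rw [this, Matrix.mul_apply]
    exact Finset.sum_nonneg fun u _ => mul_nonneg (mul_nonneg hγ0 (hP0 _ _ _)) (ih u)

lemma discMat_mulVec_const (hP1 : ∀ s a, ∑ s' : S, P s a s' = 1) (l : List (S → A)) (b : ℝ) :
    discMat P γ l *ᵥ (fun _ => b) = fun _ => γ ^ l.length * b := by
  induction l with
  | nil => simp [discMat]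
  | cons π l ih =>
    have : discMat P γ (π :: l) = (γ • polMat P π) * discMat P γ l := by simp [discMat]
    rw [this, ← Matrix.mulVec_mulVec, ih, Matrix.smul_mulVec]
    ext s
    simp only [Pi.smul_apply, smul_eq_mul, Matrix.mulVec, dotProduct, polMat,
      Matrix.of_apply, ← Finset.sum_mul, hP1, List.length_cons]
    ring

lemma nsRun_sub_nsRun (πseq : ℤ → S → A) (j : ℤ) (m : ℕ) (v w : S → ℝ) :
    nsRun P γ r πseq j m v - nsRun P γ r πseq j m w
      = discMat P γ (polWord πseq j m) *ᵥ (v - w) := by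
  induction m generalizing j with
  | zero => simp [nsRun, polWord, discMat]
  | succ m ih =>
    rw [nsRun, nsRun, bOp_sub_bOp, ih, Matrix.mulVec_mulVec]
    simp [discMat, polWord]

variable [Fintype A] [Nonempty A]

lemma bOp_le_add_errOf (v : S → ℝ) (π π' : S → A) :
    bOp P γ r π' v ≤ bOp P γ r π v + errOf P γ r v π := fun s => by
  have h := Finset.le_sup' (fun π' : S → A => bOp P γ r π' v s) (Finset.mem_univ π')
  simp only [Pi.add_apply, errOf]
  linarith

lemma errOf_nonneg (v : S → ℝ) (π : S → A) : 0 ≤ errOf P γ r v π := fun s => by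
  simpa using bOp_le_add_errOf (P := P) (γ := γ) (r := r) v π π s

/-- One step of NSPI: `u = T_{π_{j+1}} v_j − v_{j+1} + e_{j+1}` obeys `u ≤ Γ_{j+1,m} u + e_{j+1}`. -/
lemma nspi_gap_le (hP0 : ∀ s a s', 0 ≤ P s a s') (hγ0 : 0 ≤ γ) (πseq : ℤ → S → A)
    (j : ℤ) (m : ℕ) {v w : S → ℝ} (hv : nsRun P γ r πseq j m v = v)
    (hw : nsRun P γ r πseq (j+1) m w = w) :
    bOp P γ r (πseq (j+1)) v - w + errOf P γ r v (πseq (j+1)) ≤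
      discMat P γ (polWord πseq (j+1) m) *ᵥ
          (bOp P γ r (πseq (j+1)) v - w + errOf P γ r v (πseq (j+1)))
        + errOf P γ r v (πseq (j+1)) := by
  have h1 : bOp P γ r (πseq (j+1)) v
      = nsRun P γ r πseq (j+1) m (bOp P γ r (πseq (j+1-m)) v) := by
    rw [← nsRun_succ_right, nsRun, add_sub_cancel_right, hv]
  have h2 : bOp P γ r (πseq (j+1)) v - w
      = discMat P γ (polWord πseq (j+1) m) *ᵥ (bOp P γ r (πseq (j+1-m)) v - w) := by
    rw [← nsRun_sub_nsRun, hw, ← h1]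
  refine add_le_add_left (h2.le.trans (mulVec_mono_of_nonneg (discMat_nonneg hP0 hγ0 _) ?_)) _
  rw [sub_add_eq_add_sub]
  exact sub_le_sub_right (bOp_le_add_errOf v _ _) _

end Operators

lemma le_sum_pow_mulVec {S : Type*} [Fintype S] [DecidableEq S] {M : Matrix S S ℝ}
    (hM : ∀ n s t, 0 ≤ (M ^ n) s t) {u e : S → ℝ} (h : u ≤ M *ᵥ u + e) (n : ℕ) :
    u ≤ ∑ j ∈ range n, M ^ j *ᵥ e + M ^ n *ᵥ u := by
  induction n with
  | zero => simp
  | succ n ih =>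
    refine ih.trans ?_
    rw [sum_range_succ, add_assoc]
    refine add_le_add_right ((mulVec_mono_of_nonneg (hM n) h).trans ?_) _
    rw [Matrix.mulVec_add, Matrix.mulVec_mulVec, ← pow_succ, add_comm]

lemma le_pow_mulVec_add_sum {S : Type*} [Fintype S] [DecidableEq S] {M : Matrix S S ℝ}
    (hM : ∀ s t, 0 ≤ M s t) {x u : ℕ → S → ℝ} (h : ∀ j, x (j+1) ≤ M *ᵥ x j + u j) (n : ℕ) :
    x n ≤ M ^ n *ᵥ x 0 + ∑ i ∈ range n, M ^ i *ᵥ u (n - 1 - i) := by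
  induction n with
  | zero => simp
  | succ n ih =>
    refine (h n).trans ((add_le_add_left (mulVec_mono_of_nonneg hM ih) _).trans (le_of_eq ?_))
    rw [sum_range_succ', Matrix.mulVec_add, Matrix.mulVec_mulVec, ← pow_succ', add_assoc]
    congr 2
    · rw [Matrix.mulVec_sum]
      refine sum_congr rfl fun i _ => ?_
      rw [Matrix.mulVec_mulVec, ← pow_succ']
      congr 2
      lia
    · simp

lemma sum_range_mul_eq (a : ℕ → ℝ) (m n : ℕ) :
    ∑ i ∈ range (n * m), a i = ∑ j ∈ range n, ∑ t ∈ range m, a (j * m + t) := by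
  induction n with
  | zero => simp
  | succ n ih => rw [Nat.succ_mul, sum_range_add, sum_range_succ, ih]

lemma sum_range_sum_range_le_tsum {a : ℕ → ℝ} (ha : ∀ i, 0 ≤ a i) (hs : Summable a)
    {k m K : ℕ} (hK : k ≤ K * m) (n : ℕ) :
    ∑ i ∈ range k, ∑ j ∈ range n, a (i + m * j) ≤ (∑' i, a i) * K := by
  calc ∑ i ∈ range k, ∑ j ∈ range n, a (i + m * j)
      ≤ ∑ i ∈ range (K * m), ∑ j ∈ range n, a (i + m * j) :=
        sum_le_sum_of_subset_of_nonneg (range_mono hK)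
          fun _ _ _ => sum_nonneg fun _ _ => ha _
    _ = ∑ q ∈ range K, ∑ j ∈ range n, ∑ t ∈ range m, a (q * m + (j * m + t)) := by
        rw [sum_range_mul_eq]
        refine sum_congr rfl fun q _ => ?_
        rw [sum_comm]
        refine sum_congr rfl fun j _ => sum_congr rfl fun t _ => ?_
        congr 1
        ring
    _ = ∑ q ∈ range K, ∑ i ∈ range (n * m), a (q * m + i) :=
        sum_congr rfl fun q _ => (sum_range_mul_eq (fun i => a (q * m + i)) m n).symm
    _ ≤ ∑ _q ∈ range K, ∑' i, a i := by
        refine sum_le_sum fun q _ => ?_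
        refine le_trans ?_ (hs.sum_le_tsum (range (q * m + n * m)) fun i _ => ha i)
        rw [sum_range_add]
        exact le_add_of_nonneg_left (sum_nonneg fun _ _ => ha _)
    _ = (∑' i, a i) * K := by simp [mul_comm]

lemma dotProduct_discMat_mulVec_le {S A : Type*} [Fintype S] [DecidableEq S] [Nonempty A]
    {P : S → A → S → ℝ} {γ : ℝ} (hγ0 : 0 ≤ γ) {μ ν : S → ℝ} {c : ℕ → ℝ}
    (hc : ∀ (i : ℕ) (πs : ℕ → S → A) (s : S),
      Matrix.vecMul μ (((List.range i).map fun t => polMat P (πs t)).prod) s ≤ c i * ν s)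
    (l : List (S → A)) {x : S → ℝ} (hx : 0 ≤ x) :
    μ ⬝ᵥ discMat P γ l *ᵥ x ≤ γ ^ l.length * c l.length * (ν ⬝ᵥ x) := by
  have hl : ((List.range l.length).map fun t => polMat P (l.getD t (Classical.arbitrary _)))
      = l.map (polMat P) := by
    apply List.ext_getElem
    · simp
    · intro i h1 h2
      simp at h2
      simp [h2]
  have h := hc l.length fun t => l.getD t (Classical.arbitrary _)
  rw [hl] at h
  rw [discMat_eq_smul, Matrix.smul_mulVec, dotProduct_smul, Matrix.dotProduct_mulVec, smul_eq_mul,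
    mul_assoc]
  refine mul_le_mul_of_nonneg_left ?_ (pow_nonneg hγ0 _)
  rw [dotProduct, dotProduct, mul_sum]
  refine sum_le_sum fun s _ => ?_
  rw [← mul_assoc]
  exact mul_le_mul_of_nonneg_right (h s) (hx s)

lemma dotProduct_discMat_mulVec_le_of_le {S A : Type*} [Fintype S] [DecidableEq S]
    {P : S → A → S → ℝ} (hP0 : ∀ s a s', 0 ≤ P s a s') (hP1 : ∀ s a, ∑ s' : S, P s a s' = 1)
    {γ : ℝ} (hγ0 : 0 ≤ γ) {μ : S → ℝ} (hμ0 : ∀ s, 0 ≤ μ s) (hμ1 : ∑ s : S, μ s = 1)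
    (l : List (S → A)) {x : S → ℝ} {b : ℝ} (hx : ∀ s, x s ≤ b) :
    μ ⬝ᵥ discMat P γ l *ᵥ x ≤ γ ^ l.length * b := by
  have h := mulVec_mono_of_nonneg (discMat_nonneg hP0 hγ0 l) (y := fun _ => b) hx
  rw [discMat_mulVec_const hP1] at h
  calc μ ⬝ᵥ discMat P γ l *ᵥ x ≤ ∑ s, μ s * (γ ^ l.length * b) :=
        sum_le_sum fun s _ => mul_le_mul_of_nonneg_left (h s) (hμ0 s)
    _ = γ ^ l.length * b := by rw [← sum_mul, hμ1, one_mul]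

/-- for NSPI(m), if `ν e_j ≤ ε` for `1 ≤ j ≤ k` and `Σ_i γ^i c(i)` converges,
then `μ(v_{π*} − v_{k,m}) ≤ (Σ_i γ^i c(i)) ⌈k/m⌉ ε + 2 γ^k Vmax`
(that is, `μ(v_{π*} − v_{k,m}) ≤ (C^{(1,0)}/(1−γ)) ⌈k/m⌉ ε + 2 γ^k Vmax`). -/
theorem stmt7
    {S A : Type*} [Fintype S] [Fintype A] [DecidableEq S] [Nonempty S] [Nonempty A]
    (P : S → A → S → ℝ) (hP0 : ∀ s a s', 0 ≤ P s a s')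
    (hP1 : ∀ s a, ∑ s' : S, P s a s' = 1)
    (γ : ℝ) (hγ0 : 0 < γ) (hγ1 : γ < 1)
    (Rmax Vmax : ℝ) (r : S → ℝ) (hr : ∀ s, |r s| ≤ Rmax)
    (hVmax : Vmax = Rmax / (1 - γ))
    (πstar : S → A) (vstar : S → ℝ)
    (hfix : bOp P γ r πstar vstar = vstar)
    (hopt : ∀ (π : S → A) (v : S → ℝ), bOp P γ r π v = v → ∀ s, v s ≤ vstar s)
    (μ ν : S → ℝ) (hμ0 : ∀ s, 0 ≤ μ s) (hμ1 : ∑ s : S, μ s = 1)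
    (hν0 : ∀ s, 0 ≤ ν s) (hν1 : ∑ s : S, ν s = 1)
    (c : ℕ → ℝ) (hc0 : ∀ i, 0 ≤ c i)
    (hc : ∀ (i : ℕ) (πs : ℕ → S → A) (s : S),
      Matrix.vecMul μ (((List.range i).map fun t => polMat P (πs t)).prod) s ≤ c i * ν s)
    (m : ℕ) (hm : 1 ≤ m) (πseq : ℤ → S → A)
    (vN : ℕ → S → ℝ)
    (hvN : ∀ j : ℕ, nsRun P γ r πseq (j : ℤ) m (vN j) = vN j)
    (k : ℕ) (hk : 1 ≤ k)
    (ε : ℝ) (hε : 0 ≤ ε)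
    (herr : ∀ j, 1 ≤ j → j ≤ k →
      (∑ s : S, ν s * errOf P γ r (vN (j - 1)) (πseq (j : ℤ)) s) ≤ ε)
    (hsum : Summable fun i : ℕ => γ ^ i * c i) :
    (∑ s : S, μ s * (vstar s - vN k s)) ≤
      (∑' i : ℕ, γ ^ i * c i) * ((⌈(k : ℝ) / (m : ℝ)⌉ : ℤ) : ℝ) * ε + 2 * γ ^ k * Vmax := by
  set u : ℕ → S → ℝ := fun j => bOp P γ r (πseq (j+1)) (vN j) - vN (j+1)
    + errOf P γ r (vN j) (πseq (j+1)) with hu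
  set G := discMat P γ [πstar] with hG
  set W : ℕ → List (S → A) := fun j => polWord πseq (j+1) m with hW
  have hword (i n j : ℕ) : G ^ i * discMat P γ (W j) ^ n
      = discMat P γ ((List.replicate i [πstar]).flatten ++ (List.replicate n (W j)).flatten) := by
    rw [discMat_append, discMat_flatten_replicate, discMat_flatten_replicate]
  have hlen (i n j : ℕ) :
      ((List.replicate i [πstar]).flatten ++ (List.replicate n (W j)).flatten).length
        = i + m * n := by
    simp [hW, length_polWord, mul_comm]
  have hstep (j : ℕ) : vstar - vN (j+1) ≤ G *ᵥ (vstar - vN j) + u j := by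
    have h1 : G *ᵥ (vstar - vN j) = vstar - bOp P γ r πstar (vN j) := by
      conv_rhs => rw [← hfix, bOp_sub_bOp]
      simp [hG, discMat]
    rw [h1]
    intro s
    have h2 := bOp_le_add_errOf (P := P) (γ := γ) (r := r) (vN j) (πseq (j+1)) πstar s
    simp only [hu, Pi.sub_apply, Pi.add_apply] at h2 ⊢
    linarith
  have hgap (j n : ℕ) : u j ≤ ∑ i ∈ range n, discMat P γ (W j) ^ i *ᵥ
      errOf P γ r (vN j) (πseq (j+1)) + discMat P γ (W j) ^ n *ᵥ u j := by
    refine le_sum_pow_mulVec (fun n => ?_) ?_ n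
    · rw [← discMat_flatten_replicate]
      exact discMat_nonneg hP0 hγ0.le _
    · exact nspi_gap_le hP0 hγ0.le πseq j m (hvN j) (by exact_mod_cast hvN (j+1))
  clear_value u
  have hGpow (i : ℕ) : G ^ i = discMat P γ (List.replicate i [πstar]).flatten :=
    (discMat_flatten_replicate _ _).symm
  have hmain := le_pow_mulVec_add_sum (x := fun j => vstar - vN j)
    (discMat_nonneg hP0 hγ0.le _) hstep k
  have hdot {x y : S → ℝ} (h : x ≤ y) : μ ⬝ᵥ x ≤ μ ⬝ᵥ y :=
    sum_le_sum fun s _ => mul_le_mul_of_nonneg_left (h s) (hμ0 s)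
  have hinit : μ ⬝ᵥ G ^ k *ᵥ (vstar - vN 0) ≤ 2 * γ ^ k * Vmax := by
    have h1 := abs_le_of_nsRun_eq hP0 hP1 hγ0 hγ1 hr (fun _ => πstar) 0 le_rfl hfix
    have h2 := abs_le_of_nsRun_eq hP0 hP1 hγ0 hγ1 hr πseq _ hm (hvN 0)
    have h3 := dotProduct_discMat_mulVec_le_of_le hP0 hP1 hγ0.le hμ0 hμ1
      (List.replicate k [πstar]).flatten (x := vstar - vN 0) (b := 2 * Vmax) fun s => by
        have := abs_le.mp (h1 s)
        have := abs_le.mp (h2 s)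
        rw [hVmax, Pi.sub_apply]
        linarith
    rw [← hGpow] at h3
    simp only [List.length_flatten, List.map_replicate, List.length_singleton, List.sum_replicate,
      smul_eq_mul, mul_one] at h3
    linarith
  have hterm (n i : ℕ) (hi : i < k) : μ ⬝ᵥ G ^ i *ᵥ u (k - 1 - i) ≤
      (∑ j ∈ range n, γ ^ (i + m * j) * c (i + m * j)) * ε
        + γ ^ i * ‖u (k - 1 - i)‖ * (γ ^ m) ^ n := by
    set p := k - 1 - i with hp
    have h1 := hdot (mulVec_mono_of_nonneg
      (by rw [hGpow i]; exact discMat_nonneg hP0 hγ0.le _ : ∀ s t, 0 ≤ (G ^ i) s t) (hgap p n))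
    rw [Matrix.mulVec_add, Matrix.mulVec_sum, Matrix.mulVec_mulVec, dotProduct_add,
      dotProduct_sum] at h1
    refine h1.trans (add_le_add ?_ ?_)
    · rw [sum_mul]
      refine sum_le_sum fun j _ => ?_
      rw [Matrix.mulVec_mulVec, hword]
      refine (dotProduct_discMat_mulVec_le hγ0.le hc _ (errOf_nonneg _ _)).trans ?_
      rw [hlen]
      refine mul_le_mul_of_nonneg_left ?_ (mul_nonneg (pow_nonneg hγ0.le _) (hc0 _))
      have := herr (p + 1) (by lia) (by lia)
      simpa [dotProduct] using this
    · rw [hword]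
      refine (dotProduct_discMat_mulVec_le_of_le hP0 hP1 hγ0.le hμ0 hμ1 _
        (fun s => (le_abs_self _).trans (norm_le_pi_norm (u p) s))).trans (le_of_eq ?_)
      rw [hlen, pow_add, pow_mul]
      ring
  have hceil : ((⌈(k : ℝ) / (m : ℝ)⌉ : ℤ) : ℝ) = (⌈(k : ℝ) / (m : ℝ)⌉₊ : ℝ) :=
    (natCast_ceil_eq_intCast_ceil (by positivity)).symm
  have hK : k ≤ ⌈(k : ℝ) / (m : ℝ)⌉₊ * m := by
    have h := Nat.le_ceil ((k : ℝ) / (m : ℝ))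
    rw [div_le_iff₀ (by exact_mod_cast hm)] at h
    exact_mod_cast h
  rw [hceil]
  have hbound (n : ℕ) : ∑ s : S, μ s * (vstar s - vN k s) ≤
      ((∑' i : ℕ, γ ^ i * c i) * ⌈(k : ℝ) / (m : ℝ)⌉₊ * ε + 2 * γ ^ k * Vmax)
        + (∑ i ∈ range k, γ ^ i * ‖u (k - 1 - i)‖) * (γ ^ m) ^ n := by
    have h1 := hdot hmain
    rw [dotProduct_add, dotProduct_sum] at h1
    have h2 := sum_le_sum fun i hi => hterm n i (mem_range.mp hi)
    rw [sum_add_distrib, ← sum_mul, ← sum_mul] at h2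
    have h3 := mul_le_mul_of_nonneg_right (sum_range_sum_range_le_tsum
      (fun i => mul_nonneg (pow_nonneg hγ0.le i) (hc0 i)) hsum hK n) hε
    change μ ⬝ᵥ (vstar - vN k) ≤ _
    linarith
  have hlim : Filter.Tendsto (fun n : ℕ =>
      ((∑' i : ℕ, γ ^ i * c i) * ⌈(k : ℝ) / (m : ℝ)⌉₊ * ε + 2 * γ ^ k * Vmax)
        + (∑ i ∈ range k, γ ^ i * ‖u (k - 1 - i)‖) * (γ ^ m) ^ n) Filter.atTop
      (nhds (((∑' i : ℕ, γ ^ i * c i) * ⌈(k : ℝ) / (m : ℝ)⌉₊ * ε + 2 * γ ^ k * Vmax)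
        + (∑ i ∈ range k, γ ^ i * ‖u (k - 1 - i)‖) * 0)) :=
    ((tendsto_pow_atTop_nhds_zero_of_lt_one (pow_nonneg hγ0.le m)
      (pow_lt_one₀ hγ0.le hγ1 (by lia))).const_mul _).const_add _
  rw [mul_zero, add_zero] at hlim
  exact ge_of_tendsto' hlim hbound
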